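/- arXiv:1208.1592 — 2 statements merged into one kernel-verified Lean document; each statement's English description precedes it below -/
import Mathlib

section
/- Let K = ℚ(i, ζ₅) (equivalently, the 20th cyclotomic field ℚ(ζ₂₀)) and F = ℚ(i). Then for every a ∈ K and every t ∈ {1, 2, 3}, the relative field norm N_{K/F}(a) ≠ iᵗ. In other words, none of i, −1, −i is a norm from K to F, and consequently the cyclic algebra (ℚ(i,ζ₅)/ℚ(i), τ: ζ₅ ↦ ζ₅², γ = i) is a division algebra. -/
open IntermediateField

/-- The matrix of multiplication by `c₀ + c₁x + c₂x² + c₃x³` in the basis `1, x, x², x³`,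
where `x⁴ + 5x³ + 10x² + 10x + 5 = 0`, the relation satisfied by `x = ζ₅ - 1`. -/
def mulMatrix {R : Type*} [CommRing R] (c₀ c₁ c₂ c₃ : R) : Matrix (Fin 4) (Fin 4) R :=
  !![c₀, 5 * -c₃, 5 * (5 * c₃ - c₂), 5 * (5 * c₂ - c₁ - 15 * c₃);
     c₁, c₀ - 5 * (2 * c₃), 5 * (9 * c₃ - 2 * c₂), 5 * (9 * c₂ - 2 * c₁ - 25 * c₃);
     c₂, c₁ - 5 * (2 * c₃), c₀ - 5 * (2 * c₂ - 8 * c₃), 5 * (8 * c₂ - 2 * c₁ - 21 * c₃);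
     c₃, c₂ - 5 * c₃, c₁ - 5 * (c₂ - 3 * c₃), c₀ - 5 * (c₁ - 3 * c₂ + 7 * c₃)]

/-- The norm form of `R[ζ₅]` over `R` in the basis of powers of `ζ₅ - 1`. -/
def normForm {R : Type*} [CommRing R] (c₀ c₁ c₂ c₃ : R) : R :=
  (mulMatrix c₀ c₁ c₂ c₃).det

section NormForm

variable {R : Type*} [CommRing R]

lemma map_normForm {S : Type*} [CommRing S] (f : R →+* S) (c₀ c₁ c₂ c₃ : R) :
    f (normForm c₀ c₁ c₂ c₃) = normForm (f c₀) (f c₁) (f c₂) (f c₃) := by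
  rw [normForm, normForm, RingHom.map_det]
  congr 1
  ext i j
  fin_cases i <;> fin_cases j <;> simp [mulMatrix, map_ofNat f]

lemma normForm_mul (r c₀ c₁ c₂ c₃ : R) :
    normForm (r * c₀) (r * c₁) (r * c₂) (r * c₃) = r ^ 4 * normForm c₀ c₁ c₂ c₃ := by
  have h : mulMatrix (r * c₀) (r * c₁) (r * c₂) (r * c₃) = r • mulMatrix c₀ c₁ c₂ c₃ := by
    ext i j
    fin_cases i <;> fin_cases j <;> simp [mulMatrix] <;> ring
  rw [normForm, h, Matrix.det_smul, Fintype.card_fin, normForm]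

/-- Multiplicativity of the norm form for the factorization of an element with constant
coefficient `5 * e` as a multiple of `ζ₅ - 1`, which has norm `5`. -/
lemma normForm_five_mul (e c₁ c₂ c₃ : R) :
    normForm (5 * e) c₁ c₂ c₃ =
      5 * normForm (c₁ - 10 * e) (c₂ - 10 * e) (c₃ - 5 * e) (-e) := by
  simp [normForm, mulMatrix, Matrix.det_succ_row_zero, Fin.sum_univ_succ, Fin.succAbove]
  ring

lemma normForm_eq_pow_of_five_eq_zero (h : (5 : R) = 0) (c₀ c₁ c₂ c₃ : R) :
    normForm c₀ c₁ c₂ c₃ = c₀ ^ 4 := by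
  simp [normForm, mulMatrix, h, Matrix.det_succ_row_zero, Fin.sum_univ_succ, Fin.succAbove]
  ring

lemma dvd_normForm_sub_pow {p : R} (hp : p ∣ 5) (c₀ c₁ c₂ c₃ : R) :
    p ∣ normForm c₀ c₁ c₂ c₃ - c₀ ^ 4 := by
  rw [← Ideal.mem_span_singleton, ← Ideal.Quotient.eq_zero_iff_mem, map_sub, map_normForm,
    map_pow, normForm_eq_pow_of_five_eq_zero, sub_self]
  rw [← map_ofNat (Ideal.Quotient.mk (Ideal.span {p})) 5, Ideal.Quotient.eq_zero_iff_mem]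
  exact Ideal.mem_span_singleton.2 hp

end NormForm

section Descent

/-- The prime `2 + i` above `5`. -/
def primeAboveFive : GaussianInt := ⟨2, 1⟩

local notation "π" => primeAboveFive

local notation "ρ" => (⟨2, -1⟩ : GaussianInt)

lemma primeAboveFive_mul_conj : π * ρ = 5 := by decide

lemma isCoprime_primeAboveFive_conj : IsCoprime π ρ :=
  ⟨-1, π - 1, by decide⟩

lemma five_dvd_norm_of_primeAboveFive_dvd {z : GaussianInt} (h : π ∣ z) : 5 ∣ z.norm := by
  obtain ⟨w, rfl⟩ := h
  rw [Zsqrtd.norm_mul]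
  exact Dvd.intro _ rfl

lemma primeAboveFive_dvd_or (z : GaussianInt) : π ∣ z ∨ π ∣ z ^ 4 - 1 := by
  obtain ⟨x, y⟩ := z
  have h5 : π ∣ ((5 : ℤ) : GaussianInt) := ⟨ρ, by decide⟩
  have hm : π ∣ (⟨x, y⟩ : GaussianInt) - ((x - 2 * y : ℤ) : GaussianInt) :=
    ⟨(y : GaussianInt), by ext <;> simp [primeAboveFive]⟩
  have key : (5 : ℤ) ∣ (x - 2 * y) ∨ (5 : ℤ) ∣ (x - 2 * y) ^ 4 - 1 := by
    generalize x - 2 * y = m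
    have hm : m % 5 = 0 ∨ m % 5 = 1 ∨ m % 5 = 2 ∨ m % 5 = 3 ∨ m % 5 = 4 := by omega
    rcases hm with h | h | h | h | h
    · exact .inl (Int.dvd_of_emod_eq_zero h)
    all_goals
      right
      apply Int.dvd_of_emod_eq_zero
      simp [Int.sub_emod, pow_succ, Int.mul_emod, h]
  refine key.imp (fun h => ?_) (fun h => ?_)
  · exact (dvd_iff_dvd_of_dvd_sub hm).2 (h5.trans (Int.cast_dvd_cast _ _ h))
  · have h' := h5.trans (Int.cast_dvd_cast (α := GaussianInt) _ _ h)
    push_cast at h' hm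
    have := (hm.trans (sub_dvd_pow_sub_pow _ _ 4)).add h'
    simpa using this

lemma primeAboveFive_dvd_of_dvd_pow {z : GaussianInt} (h : π ∣ z ^ 4) : π ∣ z := by
  refine (primeAboveFive_dvd_or z).resolve_right fun h' => ?_
  have := five_dvd_norm_of_primeAboveFive_dvd (dvd_sub h h')
  simp at this

lemma primeAboveFive_dvd_left {c₀ c₁ c₂ c₃ : GaussianInt} (h : π ∣ normForm c₀ c₁ c₂ c₃) :
    π ∣ c₀ := by
  refine primeAboveFive_dvd_of_dvd_pow ?_
  have := dvd_normForm_sub_pow (Dvd.intro _ primeAboveFive_mul_conj) c₀ c₁ c₂ c₃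
  exact (dvd_sub_right h).1 this

/-- If the constant coefficient is `π * e`, then dividing `ρ` times the element by `ζ₅ - 1`
lowers the `π`-adic valuation of the norm by one. -/
lemma pow_dvd_normForm_shift {k : ℕ} {e c₁ c₂ c₃ : GaussianInt}
    (h : π ^ (k + 1) ∣ normForm (π * e) c₁ c₂ c₃) :
    π ^ k ∣ normForm (ρ * c₁ - 10 * e) (ρ * c₂ - 10 * e) (ρ * c₃ - 5 * e) (-e) := by
  have h1 : π ^ (k + 1) ∣ ρ ^ 4 * normForm (π * e) c₁ c₂ c₃ := h.mul_left _
  rw [← normForm_mul, show ρ * (π * e) = 5 * e by rw [← primeAboveFive_mul_conj]; ring,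
    normForm_five_mul] at h1
  generalize normForm (ρ * c₁ - 10 * e) _ _ _ = n at h1 ⊢
  rw [← primeAboveFive_mul_conj, pow_succ', mul_assoc] at h1
  have hπ : π ≠ 0 := by decide
  exact (isCoprime_primeAboveFive_conj.pow_left).dvd_of_dvd_mul_left
    ((mul_dvd_mul_iff_left hπ).1 h1)

lemma primeAboveFive_dvd_of_dvd_conj_mul_sub {c r : GaussianInt} (hr : π ∣ r)
    (h : π ∣ ρ * c - r) : π ∣ c :=
  isCoprime_primeAboveFive_conj.dvd_of_dvd_mul_left ((dvd_sub_left hr).1 h)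

lemma primeAboveFive_dvd_of_pow_dvd_normForm {c₀ c₁ c₂ c₃ : GaussianInt}
    (h : π ^ 4 ∣ normForm c₀ c₁ c₂ c₃) : π ∣ c₀ ∧ π ∣ c₁ ∧ π ∣ c₂ ∧ π ∣ c₃ := by
  have h5 : π ∣ 5 := Dvd.intro _ primeAboveFive_mul_conj
  have h10 : π ∣ 10 := h5.trans ⟨2, by decide⟩
  have hc := fun {c r : GaussianInt} => primeAboveFive_dvd_of_dvd_conj_mul_sub (c := c) (r := r)
  have d0 := primeAboveFive_dvd_left ((dvd_pow_self _ (by norm_num)).trans h)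
  obtain ⟨e₀, rfl⟩ := id d0
  replace h := pow_dvd_normForm_shift h
  have d1 := primeAboveFive_dvd_left ((dvd_pow_self _ (by norm_num)).trans h)
  obtain ⟨e₁, he₁⟩ := id d1
  rw [he₁] at h
  replace h := pow_dvd_normForm_shift h
  have d2 := primeAboveFive_dvd_left ((dvd_pow_self _ (by norm_num)).trans h)
  obtain ⟨e₂, he₂⟩ := id d2
  rw [he₂] at h
  replace h := pow_dvd_normForm_shift h
  have d3 := primeAboveFive_dvd_left ((dvd_pow_self _ (by norm_num)).trans h)
  refine ⟨d0, hc (h10.mul_right _) d1, ?_, ?_⟩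
  · exact hc (h10.mul_right _) (hc (h10.mul_right _) d2)
  · exact hc (h5.mul_right _) (hc (h10.mul_right _) (hc (h10.mul_right _) d3))

lemma normForm_ne_pow_mul (u : GaussianInt) (hu : IsUnit u) (hu1 : ¬ π ∣ u - 1) (d : GaussianInt)
    (hd : d ≠ 0) (c₀ c₁ c₂ c₃ : GaussianInt) : normForm c₀ c₁ c₂ c₃ ≠ d ^ 4 * u := by
  have hπ : π ≠ 0 := by decide
  have hπu : ¬ IsUnit π := fun h => by
    have := five_dvd_norm_of_primeAboveFive_dvd (h.dvd (a := 1))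
    simp at this
  induction d using (wellFounded_dvdNotUnit (α := GaussianInt)).induction generalizing c₀ c₁ c₂ c₃ with
  | _ d ih =>
  intro h
  by_cases hpd : π ∣ d
  · obtain ⟨d, rfl⟩ := hpd
    have hdvd : π ^ 4 ∣ normForm c₀ c₁ c₂ c₃ := by
      rw [h, mul_pow, mul_assoc]
      exact Dvd.intro _ rfl
    obtain ⟨⟨e₀, rfl⟩, ⟨e₁, rfl⟩, ⟨e₂, rfl⟩, ⟨e₃, rfl⟩⟩ :=
      primeAboveFive_dvd_of_pow_dvd_normForm hdvd
    rw [normForm_mul, mul_pow, mul_assoc] at h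
    have hd' := right_ne_zero_of_mul hd
    exact ih d ⟨hd', π, hπu, mul_comm _ _⟩ hd' _ _ _ _ (mul_left_cancel₀ (pow_ne_zero 4 hπ) h)
  · have hd4 := (primeAboveFive_dvd_or d).resolve_left hpd
    have hN := dvd_normForm_sub_pow (Dvd.intro _ primeAboveFive_mul_conj) c₀ c₁ c₂ c₃
    have hc0 : ¬ π ∣ c₀ := fun hc => hpd <| primeAboveFive_dvd_of_dvd_pow <| by
      rw [← hu.dvd_mul_right, ← h]
      exact (dvd_sub_left (dvd_pow hc (by norm_num))).1 hN
    have hc4 := (primeAboveFive_dvd_or c₀).resolve_left hc0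
    apply hu1
    rw [h] at hN
    convert (hN.add hc4).sub (hd4.mul_right u) using 1
    ring

end Descent

/-- Every element of `ℚ(i)` is a quotient of Gaussian integers. -/
lemma exists_gaussianInt_mul_eq (x : ℂ) (hx : x ∈ ℚ⟮Complex.I⟯) :
    ∃ d z : GaussianInt, d ≠ 0 ∧ (d : ℂ) * x = z := by
  induction hx using IntermediateField.adjoin_induction with
  | mem x hx =>
    obtain rfl := hx
    exact ⟨1, ⟨0, 1⟩, one_ne_zero, by simp [GaussianInt.toComplex_def]⟩
  | algebraMap q =>
    refine ⟨q.den, q.num, by exact_mod_cast q.den_nz, ?_⟩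
    simp only [map_natCast, map_intCast, eq_ratCast]
    exact_mod_cast Rat.den_mul_eq_num q
  | add x y _ _ hx hy =>
    obtain ⟨d, z, hd, hz⟩ := hx
    obtain ⟨e, w, he, hw⟩ := hy
    exact ⟨d * e, e * z + d * w, mul_ne_zero hd he, by
      rw [map_mul, map_add, map_mul, map_mul, ← hz, ← hw]; ring⟩
  | inv x _ hx =>
    obtain ⟨d, z, hd, hz⟩ := hx
    rcases eq_or_ne x 0 with rfl | hx0
    · exact ⟨1, 0, one_ne_zero, by simp⟩
    · refine ⟨z, d, fun h => ?_, by rw [← hz]; field_simp⟩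
      simp [h, hd, hx0] at hz
  | mul x y _ _ hx hy =>
    obtain ⟨d, z, hd, hz⟩ := hx
    obtain ⟨e, w, he, hw⟩ := hy
    exact ⟨d * e, z * w, mul_ne_zero hd he, by rw [map_mul, map_mul, ← hz, ← hw]; ring⟩

lemma isPrimitiveRoot_I_four : IsPrimitiveRoot Complex.I 4 := by
  refine IsPrimitiveRoot.mk_of_lt _ (by norm_num) Complex.I_pow_four fun l hl hl4 h => ?_
  interval_cases l <;> norm_num [Complex.ext_iff, pow_succ] at h

lemma finrank_adjoin_I_le : Module.finrank ℚ ℚ⟮Complex.I⟯ ≤ 2 := by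
  have hI : Polynomial.aeval Complex.I (Polynomial.X ^ 2 + 1 : Polynomial ℚ) = 0 := by simp
  have hm : (Polynomial.X ^ 2 + 1 : Polynomial ℚ).Monic := by monicity!
  rw [IntermediateField.adjoin.finrank ⟨_, hm, hI⟩]
  refine (Polynomial.natDegree_le_of_dvd (minpoly.dvd ℚ _ hI) hm.ne_zero).trans ?_
  compute_degree

lemma finrank_adjoin_five (ζ : ℂ) (hζ : IsPrimitiveRoot ζ 5) :
    Module.finrank ℚ⟮Complex.I⟯ ℚ⟮Complex.I⟯⟮ζ⟯ = 4 := by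
  have hζi : IsIntegral ℚ⟮Complex.I⟯ ζ := hζ.isIntegral (by norm_num) |>.tower_top
  have hIi : IsIntegral ℚ Complex.I := isPrimitiveRoot_I_four.isIntegral (by norm_num) |>.tower_top
  have := IntermediateField.adjoin.finiteDimensional hζi
  have := IntermediateField.adjoin.finiteDimensional hIi
  have : FiniteDimensional ℚ ℚ⟮Complex.I⟯⟮ζ⟯ := FiniteDimensional.trans ℚ ℚ⟮Complex.I⟯ _
  apply le_antisymm
  · rw [IntermediateField.adjoin.finrank hζi]
    have h0 : Polynomial.aeval ζ (Polynomial.cyclotomic 5 ℚ⟮Complex.I⟯) = 0 := by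
      rw [Polynomial.aeval_def, Polynomial.eval₂_eq_eval_map, Polynomial.map_cyclotomic]
      exact hζ.isRoot_cyclotomic (by norm_num)
    refine (Polynomial.natDegree_le_of_dvd (minpoly.dvd _ _ h0)
      (Polynomial.cyclotomic_ne_zero _ _)).trans ?_
    rw [Polynomial.natDegree_cyclotomic]
    decide
  · have h1 : IsPrimitiveRoot (algebraMap ℚ⟮Complex.I⟯ ℚ⟮Complex.I⟯⟮ζ⟯
        (AdjoinSimple.gen ℚ Complex.I)) 4 :=
      IsPrimitiveRoot.of_map_of_injective (f := algebraMap ℚ⟮Complex.I⟯⟮ζ⟯ ℂ)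
        isPrimitiveRoot_I_four (FaithfulSMul.algebraMap_injective _ _)
    have h2 : IsPrimitiveRoot (AdjoinSimple.gen ℚ⟮Complex.I⟯ ζ) 5 :=
      IsPrimitiveRoot.of_map_of_injective (f := algebraMap ℚ⟮Complex.I⟯⟮ζ⟯ ℂ)
        hζ (FaithfulSMul.algebraMap_injective _ _)
    have h3 := IsPrimitiveRoot.lcm_totient_le_finrank h1 h2
      (Polynomial.cyclotomic.irreducible_rat (by decide))
    rw [← Module.finrank_mul_finrank ℚ ℚ⟮Complex.I⟯] at h3
    have h4 : (Nat.lcm 4 5).totient = 8 := by decide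
    have := Nat.mul_le_mul_right (Module.finrank ℚ⟮Complex.I⟯ ℚ⟮Complex.I⟯⟮ζ⟯) finrank_adjoin_I_le
    omega

lemma norm_eq_normForm {F K : Type*} [Field F] [Field K] [Algebra F K]
    [IsCyclotomicExtension {5} F K] {ζ : K} (hζ : IsPrimitiveRoot ζ 5)
    (h : Module.finrank F K = 4) (a : K) :
    ∃ c₀ c₁ c₂ c₃ : F, Algebra.norm F a = normForm c₀ c₁ c₂ c₃ := by
  have hdim : (hζ.subOnePowerBasis F).dim = 4 := by rw [← PowerBasis.finrank, h]
  let b : Module.Basis (Fin 4) F K := (hζ.subOnePowerBasis F).basis.reindex (finCongr hdim)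
  have hb : ∀ i, b i = (ζ - 1) ^ (i : ℕ) := fun i => by simp [b]
  refine ⟨b.repr a 0, b.repr a 1, b.repr a 2, b.repr a 3, ?_⟩
  rw [Algebra.norm_eq_matrix_det b, normForm]
  congr 1
  have hx : 1 + ζ + ζ ^ 2 + ζ ^ 3 + ζ ^ 4 = 0 := by
    simpa [Finset.sum_range_succ] using hζ.geom_sum_eq_zero (by norm_num)
  have ha := b.sum_repr a
  rw [Fin.sum_univ_four] at ha
  generalize b.repr a 0 = c₀, b.repr a 1 = c₁, b.repr a 2 = c₂, b.repr a 3 = c₃ at ha ⊢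
  have key : ∀ j, a * b j = ∑ i, mulMatrix c₀ c₁ c₂ c₃ i j • b i := fun j => by
    rw [← ha]
    fin_cases j <;>
      simp [Fin.sum_univ_four, hb, mulMatrix, Algebra.smul_def, map_ofNat (algebraMap F K)]
    · linear_combination algebraMap F K c₃ * hx
    · linear_combination (algebraMap F K c₂ + algebraMap F K c₃ * (ζ - 6)) * hx
    · linear_combination (algebraMap F K c₁ + algebraMap F K c₂ * (ζ - 6) +
        algebraMap F K c₃ * ((ζ - 1) ^ 2 - 5 * (ζ - 1) + 15)) * hx
  ext i j
  rw [Algebra.leftMulMatrix_eq_repr_mul, key, b.repr_sum_self]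

/-- For `K = ℚ(i, ζ₅)` and `F = ℚ(i)`, no element of `K` has relative norm `iᵗ`
for `t ∈ {1,2,3}`; in particular none of `i, -1, -i` is a norm from `K` to `F`,
so the cyclic algebra `(ℚ(i,ζ₅)/ℚ(i), τ : ζ₅ ↦ ζ₅², γ = i)` is a division algebra. -/
theorem statement_0 (ζ : ℂ) (hζ : IsPrimitiveRoot ζ 5)
    (a : ℚ⟮Complex.I⟯⟮ζ⟯) (t : ℕ) (ht : t ∈ ({1, 2, 3} : Set ℕ)) :
    ((Algebra.norm ℚ⟮Complex.I⟯ a : ℚ⟮Complex.I⟯) : ℂ) ≠ Complex.I ^ t := by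
  have : IsCyclotomicExtension {5} ℚ⟮Complex.I⟯ ℚ⟮Complex.I⟯⟮ζ⟯ := by
    change IsCyclotomicExtension {5} ℚ⟮Complex.I⟯ ℚ⟮Complex.I⟯⟮ζ⟯.toSubalgebra
    rw [IntermediateField.adjoin_simple_toSubalgebra_of_isAlgebraic
      ((hζ.isIntegral (by norm_num)).tower_top.isAlgebraic)]
    exact hζ.adjoin_isCyclotomicExtension _
  have hgen : IsPrimitiveRoot (AdjoinSimple.gen ℚ⟮Complex.I⟯ ζ) 5 :=
    IsPrimitiveRoot.of_map_of_injective (f := algebraMap ℚ⟮Complex.I⟯⟮ζ⟯ ℂ)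
      hζ (FaithfulSMul.algebraMap_injective _ _)
  obtain ⟨c₀, c₁, c₂, c₃, hN⟩ := norm_eq_normForm hgen (finrank_adjoin_five ζ hζ) a
  obtain ⟨d₀, z₀, hd₀, hz₀⟩ := exists_gaussianInt_mul_eq c₀ c₀.2
  obtain ⟨d₁, z₁, hd₁, hz₁⟩ := exists_gaussianInt_mul_eq c₁ c₁.2
  obtain ⟨d₂, z₂, hd₂, hz₂⟩ := exists_gaussianInt_mul_eq c₂ c₂.2
  obtain ⟨d₃, z₃, hd₃, hz₃⟩ := exists_gaussianInt_mul_eq c₃ c₃.2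
  intro h
  rw [hN, ← IntermediateField.algebraMap_apply, map_normForm] at h
  simp only [IntermediateField.algebraMap_apply] at h
  let i : GaussianInt := ⟨0, 1⟩
  have hi : (i : ℂ) = Complex.I := by simp [i, GaussianInt.toComplex_def]
  have hiu : IsUnit i := IsUnit.of_mul_eq_one ⟨0, -1⟩ (by decide)
  refine normForm_ne_pow_mul (i ^ t) (hiu.pow t) (fun hdvd => ?_) (d₀ * d₁ * d₂ * d₃) (by positivity)
    (d₁ * d₂ * d₃ * z₀) (d₀ * d₂ * d₃ * z₁) (d₀ * d₁ * d₃ * z₂) (d₀ * d₁ * d₂ * z₃)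
    (GaussianInt.toComplex_injective ?_)
  · have h5 := five_dvd_norm_of_primeAboveFive_dvd hdvd
    rcases ht with rfl | rfl | rfl <;> revert h5 <;> decide
  · rw [map_normForm, map_mul _ (_ ^ 4), map_pow, map_pow, hi, ← h, ← normForm_mul]
    simp only [map_mul, ← hz₀, ← hz₁, ← hz₂, ← hz₃]
    congr 1 <;> ring
end

section
/- Let K = ℚ(ω, ζ₇) (equivalently, the 21st cyclotomic field ℚ(ζ₂₁)) and F = ℚ(ω), where ω is a primitive cube root of unity. Then for every a ∈ K and every t ∈ {1, 2, 3, 4, 5}, the relative field norm N_{K/F}(a) ≠ (−ω)ᵗ. In other words, none of −ω, ω², −1, ω, −ω² is a norm from K to F, and consequently the cyclic algebra (ℚ(ω,ζ₇)/ℚ(ω), τ: ζ₇ ↦ ζ₇³, γ = −ω) is a division algebra. -/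
open IntermediateField

open Polynomial in
/-- An integer polynomial whose value at `1` is divisible by the prime `p` is a multiple of
`1 - X` modulo the `p`-th cyclotomic polynomial. -/
theorem exists_eq_one_sub_X_mul_add_cyclotomic (p : ℕ) [Fact p.Prime] (P : ℤ[X])
    (hP : (p : ℤ) ∣ P.eval 1) :
    ∃ P' : ℤ[X], ∃ d : ℤ, P = (1 - X) * P' + C d * cyclotomic p ℤ := by
  obtain ⟨d, hd⟩ := hP
  obtain ⟨Q, hQ⟩ : (X - C 1) ∣ P - C d * cyclotomic p ℤ := by
    rw [dvd_iff_isRoot, IsRoot.def]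
    simp [eval_one_cyclotomic_prime, hd, mul_comm]
  refine ⟨-Q, d, ?_⟩
  rw [C_1] at hQ
  linear_combination hQ

section Descent

open Polynomial

variable {S k : Type*} [CommRing S] [IsDomain S] [Field k] [CharP k 7]

/-- The value at `1` of the seventh cyclotomic polynomial, as a product over its roots. -/
theorem prod_one_sub_primitiveRoots_seven {ζ : S} (hζ : IsPrimitiveRoot ζ 7) :
    ∏ μ ∈ primitiveRoots 7 S, (1 - μ) = 7 := by
  have : Fact (Nat.Prime 7) := ⟨by norm_num⟩
  have h := congrArg (eval 1) (cyclotomic_eq_prod_X_sub_primitiveRoots hζ)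
  rw [eval_one_cyclotomic_prime, eval_prod] at h
  simpa using h.symm

theorem intCast_pow_six_eq_one {c : ℤ} (hc : (c : k) ≠ 0) : (c : k) ^ 6 = 1 := by
  have : Fact (Nat.Prime 7) := ⟨by norm_num⟩
  have h : (c : ZMod 7) ≠ 0 := fun h => hc <| by
    rw [CharP.intCast_eq_zero_iff k 7]; exact_mod_cast (ZMod.intCast_zmod_eq_zero_iff_dvd c 7).1 h
  have h6 := congrArg (ZMod.castHom dvd_rfl k) (ZMod.pow_card_sub_one_eq_one h)
  simpa using h6

/-- If a product of conjugates of an element of `ℤ[ω, ζ₇]` is a power of `7` times an element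
prime to `7`, then this cofactor is `1` modulo the primes above `7`. -/
theorem map_eq_one_of_prod_eq_seven_pow_mul {ζ ω : S} (h7 : (7 : S) ≠ 0)
    (hζ : IsPrimitiveRoot ζ 7) (hω : ω ^ 2 + ω + 1 = 0) (φ : S →+* k)
    {r r' : ℤ} (hr : φ ω = r) (hsum : r + r' = 6) (hprod : r * r' = 8)
    (n : ℕ) (P Q : ℤ[X]) (w : S) (hw : φ w ≠ 0)
    (h : ∏ μ ∈ primitiveRoots 7 S, (aeval μ P + ω * aeval μ Q) = 7 ^ n * w) : φ w = 1 := by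
  have : Fact (Nat.Prime 7) := ⟨by norm_num⟩
  have h7k : (7 : k) = 0 := by exact_mod_cast CharP.cast_eq_zero k 7
  have hcard : (primitiveRoots 7 S).card = 6 := by
    rw [hζ.card_primitiveRoots]; decide
  have hφ : ∀ P Q : ℤ[X], φ (∏ μ ∈ primitiveRoots 7 S, (aeval μ P + ω * aeval μ Q)) =
      ((P.eval 1 + r * Q.eval 1 : ℤ) : k) ^ 6 := by
    intro P Q
    rw [map_prod, ← hcard]
    refine Finset.prod_eq_pow_card fun μ hμ => ?_
    have hμ7 : φ μ = 1 := by
      have h1 : φ μ ^ 7 = 1 := by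
        rw [← map_pow, (isPrimitiveRoot_of_mem_primitiveRoots hμ).pow_eq_one, map_one]
      have h2 : (φ μ - 1) ^ 7 = 0 := by rw [sub_pow_char (R := k) (p := 7), h1]; simp
      exact sub_eq_zero.1 (pow_eq_zero_iff (by norm_num) |>.1 h2)
    have hev : ∀ P : ℤ[X], φ (aeval μ P) = ((P.eval 1 : ℤ) : k) := fun P => by
      rw [aeval_def, hom_eval₂, hμ7, Subsingleton.elim (φ.comp _) (Int.castRingHom k),
        ← map_one (Int.castRingHom k), eval₂_at_apply, eq_intCast]
    rw [map_add, map_mul, hev, hev, hr]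
    push_cast
    ring
  induction n generalizing P Q w with
  | zero =>
    have hw' := hφ P Q
    rw [h, pow_zero, one_mul] at hw'
    rw [hw'] at hw ⊢
    exact intCast_pow_six_eq_one (by simpa using hw)
  | succ n ih =>
    have hdvd : (7 : ℤ) ∣ P.eval 1 + r * Q.eval 1 := by
      refine (CharP.intCast_eq_zero_iff k 7 _).1 ?_
      have h0 := hφ P Q
      rw [h, pow_succ, map_mul, map_mul, map_ofNat, h7k, mul_zero, zero_mul] at h0
      exact pow_eq_zero_iff (by norm_num) |>.1 h0.symm
    obtain ⟨e, he⟩ := hdvd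
    obtain ⟨P', c, hP'⟩ := exists_eq_one_sub_X_mul_add_cyclotomic 7 (-Q - C r' * P)
      ⟨Q.eval 1 - r' * e, by
        simp only [eval_sub, eval_neg, eval_mul, eval_C]
        linear_combination (-r') * he + Q.eval 1 * hprod⟩
    obtain ⟨Q', d, hQ'⟩ := exists_eq_one_sub_X_mul_add_cyclotomic 7 (P - C (1 + r') * Q)
      ⟨e - Q.eval 1, by
        simp only [eval_sub, eval_mul, eval_C]
        linear_combination he - Q.eval 1 * hsum⟩
    have hmul : ∀ μ ∈ primitiveRoots 7 S, (ω - r') * (aeval μ P + ω * aeval μ Q) =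
        (1 - μ) * (aeval μ P' + ω * aeval μ Q') := fun μ hμ => by
      have hroot : aeval μ (cyclotomic 7 ℤ) = 0 := by
        rw [aeval_def, ← eval_map, map_cyclotomic]
        exact (isPrimitiveRoot_of_mem_primitiveRoots hμ).isRoot_cyclotomic (by norm_num)
      have hP := congrArg (aeval μ) hP'
      have hQ := congrArg (aeval μ) hQ'
      simp only [map_sub, map_neg, map_add, map_mul, map_one, aeval_X, hroot,
        eq_intCast, map_intCast, mul_zero, add_zero] at hP hQ
      linear_combination hP + ω * hQ + aeval μ Q * hω
    have hN := Finset.prod_congr rfl hmul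
    rw [Finset.prod_mul_distrib, Finset.prod_mul_distrib, Finset.prod_const, hcard, h,
      prod_one_sub_primitiveRoots_seven hζ] at hN
    have hu : φ ((ω - r') ^ 6) = 1 := by
      have h0 : ((r - r' : ℤ) : k) ≠ 0 := by
        rw [Ne, CharP.intCast_eq_zero_iff k 7]
        rintro ⟨m, hm⟩
        have : (7 * m) ^ 2 = 4 := by
          push_cast at hm
          rw [← hm]; linear_combination (r + r' + 6) * hsum - 4 * hprod
        have : 49 * m ^ 2 = 4 := by linarith
        omega
      rw [map_pow, map_sub, hr, map_intCast, ← Int.cast_sub, intCast_pow_six_eq_one h0]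
    have hw' : φ (w * (ω - r') ^ 6) = φ w := by rw [map_mul, hu, mul_one]
    rw [← hw']
    have hN' : ∏ μ ∈ primitiveRoots 7 S, (aeval μ P' + ω * aeval μ Q') =
        7 ^ n * (w * (ω - r') ^ 6) := mul_left_cancel₀ h7 (by rw [← hN]; ring)
    exact ih P' Q' _ (by rwa [hw']) hN'

end Descent

open Polynomial in
/-- The seventh cyclotomic polynomial stays irreducible over `ℚ(ω)`. -/
theorem cyclotomic_seven_irreducible_adjoin {ω ζ : ℂ} (hω : IsPrimitiveRoot ω 3)
    (hζ : IsPrimitiveRoot ζ 7) : Irreducible (cyclotomic 7 ℚ⟮ω⟯) := by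
  have : FiniteDimensional ℚ ℚ⟮ω⟯ :=
    adjoin.finiteDimensional ((hω.isIntegral (by norm_num)).tower_top)
  have hint : IsIntegral ℚ⟮ω⟯ ζ := (hζ.isIntegral (by norm_num)).tower_top
  have : FiniteDimensional ℚ⟮ω⟯ ℚ⟮ω⟯⟮ζ⟯ := adjoin.finiteDimensional hint
  have : FiniteDimensional ℚ ℚ⟮ω⟯⟮ζ⟯ := FiniteDimensional.trans ℚ ℚ⟮ω⟯ ℚ⟮ω⟯⟮ζ⟯
  have hF : Module.finrank ℚ ℚ⟮ω⟯ = 2 := by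
    rw [adjoin.finrank ((hω.isIntegral (by norm_num)).tower_top),
      ← cyclotomic_eq_minpoly_rat hω (by norm_num), natDegree_cyclotomic]
    decide
  let ω' : ℚ⟮ω⟯⟮ζ⟯ := algebraMap ℚ⟮ω⟯ _ (AdjoinSimple.gen ℚ ω)
  have hω' : IsPrimitiveRoot ω' 3 :=
    IsPrimitiveRoot.of_map_of_injective (f := algebraMap ℚ⟮ω⟯⟮ζ⟯ ℂ) hω
      (algebraMap ℚ⟮ω⟯⟮ζ⟯ ℂ).injective
  have hζ' : IsPrimitiveRoot (AdjoinSimple.gen ℚ⟮ω⟯ ζ) 7 :=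
    IsPrimitiveRoot.of_map_of_injective (f := algebraMap ℚ⟮ω⟯⟮ζ⟯ ℂ) hζ
      (algebraMap ℚ⟮ω⟯⟮ζ⟯ ℂ).injective
  have hle := hω'.lcm_totient_le_finrank hζ' (cyclotomic.irreducible_rat (by decide))
  rw [← Module.finrank_mul_finrank ℚ ℚ⟮ω⟯ ℚ⟮ω⟯⟮ζ⟯, hF, adjoin.finrank hint,
    show (Nat.lcm 3 7).totient = 12 by decide] at hle
  have hdvd : minpoly ℚ⟮ω⟯ ζ ∣ cyclotomic 7 ℚ⟮ω⟯ := by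
    refine minpoly.dvd _ _ ?_
    rw [aeval_def, ← eval_map, map_cyclotomic]
    exact hζ.isRoot_cyclotomic (by norm_num)
  have heq : cyclotomic 7 ℚ⟮ω⟯ = minpoly ℚ⟮ω⟯ ζ := by
    refine (eq_of_monic_of_dvd_of_natDegree_le (minpoly.monic hint) (cyclotomic.monic 7 _)
      hdvd ?_)
    rw [natDegree_cyclotomic, show Nat.totient 7 = 6 by decide]
    omega
  rw [heq]
  exact minpoly.irreducible hint

open Polynomial in
/-- The norm from `ℚ(ω, ζ₇)` to `ℚ(ω)` of an element with an integer multiple in `ℤ[ω, ζ₇]`, as a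
product over the conjugates of `ζ₇`. -/
theorem norm_eq_prod_primitiveRoots_seven {ω ζ : ℂ} (hω : IsPrimitiveRoot ω 3)
    (hζ : IsPrimitiveRoot ζ 7) (a : ℚ⟮ω⟯⟮ζ⟯) (m : ℤ) (P Q : ℤ[X])
    (h : m * (a : ℂ) = aeval ζ P + ω * aeval ζ Q) :
    (m : ℂ) ^ 6 * ((Algebra.norm ℚ⟮ω⟯ a : ℚ⟮ω⟯) : ℂ) =
      ∏ μ ∈ primitiveRoots 7 ℂ, (aeval μ P + ω * aeval μ Q) := by
  have hint : IsIntegral ℚ⟮ω⟯ ζ := (hζ.isIntegral (by norm_num)).tower_top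
  have : FiniteDimensional ℚ⟮ω⟯ ℚ⟮ω⟯⟮ζ⟯ := adjoin.finiteDimensional hint
  have : IsCyclotomicExtension {7} ℚ⟮ω⟯ ℚ⟮ω⟯⟮ζ⟯ := by
    change IsCyclotomicExtension {7} ℚ⟮ω⟯ ℚ⟮ω⟯⟮ζ⟯.toSubalgebra
    rw [adjoin_simple_toSubalgebra_of_isAlgebraic hint.isAlgebraic]
    exact hζ.adjoin_isCyclotomicExtension ℚ⟮ω⟯
  let ζ' := AdjoinSimple.gen ℚ⟮ω⟯ ζ
  have hζ' : IsPrimitiveRoot ζ' 7 :=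
    IsPrimitiveRoot.of_map_of_injective (f := algebraMap ℚ⟮ω⟯⟮ζ⟯ ℂ) hζ
      (algebraMap ℚ⟮ω⟯⟮ζ⟯ ℂ).injective
  have hK : (m : ℚ⟮ω⟯⟮ζ⟯) * a =
      aeval ζ' P + algebraMap ℚ⟮ω⟯ _ (AdjoinSimple.gen ℚ ω) * aeval ζ' Q := by
    apply (algebraMap ℚ⟮ω⟯⟮ζ⟯ ℂ).injective
    rw [map_mul, map_add, map_mul, ← aeval_algebraMap_apply, ← aeval_algebraMap_apply,
      map_intCast]
    exact h
  have hirr := cyclotomic_seven_irreducible_adjoin hω hζ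
  have hcard : (primitiveRoots 7 ℂ).card = 6 := by
    rw [hζ.card_primitiveRoots]; decide
  let e := hζ'.embeddingsEquivPrimitiveRoots ℂ hirr
  have hnorm : ((Algebra.norm ℚ⟮ω⟯ a : ℚ⟮ω⟯) : ℂ) = ∏ σ : ℚ⟮ω⟯⟮ζ⟯ →ₐ[ℚ⟮ω⟯] ℂ, σ a :=
    Algebra.norm_eq_prod_embeddings ℚ⟮ω⟯ ℂ a
  have hone : ∀ σ : ℚ⟮ω⟯⟮ζ⟯ →ₐ[ℚ⟮ω⟯] ℂ,
      m * σ a = aeval (e σ : ℂ) P + ω * aeval (e σ : ℂ) Q := fun σ => by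
    have := congrArg σ hK
    rw [map_mul, map_add, map_mul, map_intCast, AlgHom.commutes] at this
    rw [this]
    have hσ : ∀ P : ℤ[X], σ (aeval ζ' P) = aeval (σ ζ') P := fun P =>
      (aeval_algHom_apply (σ.restrictScalars ℤ) ζ' P).symm
    rw [hσ, hσ]
    rfl
  rw [← Finset.prod_coe_sort, ← e.prod_comp, hnorm, ← Finset.prod_congr rfl (fun σ _ => hone σ),
    Finset.prod_mul_distrib, Finset.prod_const, Finset.card_univ, Fintype.card_congr e,
    Fintype.card_coe, hcard]

open Polynomial in
/-- Every element of `ℚ(ω, ζ₇)` has a nonzero integer multiple in `ℤ[ω, ζ₇]`. -/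
theorem exists_int_mul_eq_aeval_add_mul_aeval {ω ζ : ℂ} (hω : IsPrimitiveRoot ω 3)
    (hζ : IsPrimitiveRoot ζ 7) (a : ℚ⟮ω⟯⟮ζ⟯) :
    ∃ m : ℤ, m ≠ 0 ∧ ∃ P Q : ℤ[X], m * (a : ℂ) = aeval ζ P + ω * aeval ζ Q := by
  have hω2 : ω ^ 2 + ω + 1 = 0 := by
    have := hω.isRoot_cyclotomic (by norm_num)
    simpa [cyclotomic_three] using this
  let R : Subalgebra ℚ ℂ :=
    { carrier := {x | ∃ m : ℤ, m ≠ 0 ∧ ∃ P Q : ℤ[X], m * x = aeval ζ P + ω * aeval ζ Q}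
      mul_mem' := by
        rintro x y ⟨m, hm, P, Q, h⟩ ⟨m', hm', P', Q', h'⟩
        refine ⟨m * m', mul_ne_zero hm hm', P * P' - Q * Q', P * Q' + Q * P' - Q * Q', ?_⟩
        push_cast
        simp only [map_sub, map_add, map_mul]
        linear_combination m' * y * h + (aeval ζ P + ω * aeval ζ Q) * h' +
          aeval ζ Q * aeval ζ Q' * hω2
      add_mem' := by
        rintro x y ⟨m, hm, P, Q, h⟩ ⟨m', hm', P', Q', h'⟩
        refine ⟨m * m', mul_ne_zero hm hm', C m' * P + C m * P', C m' * Q + C m * Q', ?_⟩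
        push_cast
        simp only [map_add, map_mul, eq_intCast, map_intCast]
        linear_combination m' * h + m * h'
      algebraMap_mem' := fun q => by
        refine ⟨q.den, by exact_mod_cast q.den_nz, C q.num, 0, ?_⟩
        have := Rat.den_mul_eq_num q
        simp only [eq_intCast, map_intCast, map_zero, mul_zero, add_zero, eq_ratCast]
        exact_mod_cast congrArg (Rat.cast : ℚ → ℂ) this }
  have hωR : ω ∈ R := ⟨1, one_ne_zero, 0, 1, by simp⟩
  have hζR : ζ ∈ R := ⟨1, one_ne_zero, X, 0, by simp⟩
  have hF : ∀ x ∈ ℚ⟮ω⟯, x ∈ R := fun x hx => by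
    rw [← mem_toSubalgebra, adjoin_simple_toSubalgebra_of_isAlgebraic
      (hω.isIntegral (by norm_num)).tower_top.isAlgebraic] at hx
    exact Algebra.adjoin_le (by simpa using hωR) hx
  have ha : (a : ℂ) ∈ Algebra.adjoin ℚ⟮ω⟯ {ζ} := by
    rw [← adjoin_simple_toSubalgebra_of_isAlgebraic
      (hζ.isIntegral (by norm_num)).tower_top.isAlgebraic]
    exact a.2
  change (a : ℂ) ∈ R
  generalize (a : ℂ) = x at ha
  induction ha using Algebra.adjoin_induction with
  | mem x hx => rw [Set.mem_singleton_iff.1 hx]; exact hζR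
  | algebraMap r => exact hF r r.2
  | add x y _ _ hx hy => exact R.add_mem hx hy
  | mul x y _ _ hx hy => exact R.mul_mem hx hy

/-- For `K = ℚ(ω, ζ₇)` and `F = ℚ(ω)` (`ω` a primitive cube root of unity), no element
of `K` has relative norm `(-ω)ᵗ` for `t ∈ {1,...,5}`; in particular none of
`-ω, ω², -1, ω, -ω²` is a norm from `K` to `F`, so the cyclic algebra
`(ℚ(ω,ζ₇)/ℚ(ω), τ : ζ₇ ↦ ζ₇³, γ = -ω)` is a division algebra. -/
theorem statement_7 (ω ζ : ℂ) (hω : IsPrimitiveRoot ω 3) (hζ : IsPrimitiveRoot ζ 7)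
    (a : ℚ⟮ω⟯⟮ζ⟯) (t : ℕ) (ht : t ∈ ({1, 2, 3, 4, 5} : Set ℕ)) :
    ((Algebra.norm ℚ⟮ω⟯ a : ℚ⟮ω⟯) : ℂ) ≠ (-ω) ^ t := by
  intro hnorm
  obtain ⟨m, hm, P, Q, hPQ⟩ := exists_int_mul_eq_aeval_add_mul_aeval hω hζ a
  have hprod := norm_eq_prod_primitiveRoots_seven hω hζ a m P Q hPQ
  rw [hnorm] at hprod
  let S := integralClosure ℤ ℂ
  let ωS : S := ⟨ω, hω.isIntegral (by norm_num)⟩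
  let ζS : S := ⟨ζ, hζ.isIntegral (by norm_num)⟩
  have hinj : Function.Injective (algebraMap S ℂ) := Subtype.val_injective
  have hζS : IsPrimitiveRoot ζS 7 := .of_map_of_injective (f := algebraMap S ℂ) hζ hinj
  have hω2 : ωS ^ 2 + ωS + 1 = 0 := by
    have h3 : IsPrimitiveRoot ωS 3 := .of_map_of_injective (f := algebraMap S ℂ) hω hinj
    simpa [Polynomial.cyclotomic_three] using h3.isRoot_cyclotomic (by norm_num)
  have hprodS : ∏ μ ∈ primitiveRoots 7 S, (Polynomial.aeval μ P + ωS * Polynomial.aeval μ Q) =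
      m ^ 6 * (-ωS) ^ t := by
    apply hinj
    have himg : primitiveRoots 7 ℂ = (primitiveRoots 7 S).map ⟨algebraMap S ℂ, hinj⟩ := by
      symm
      refine Finset.eq_of_subset_of_card_le (fun x hx => ?_) ?_
      · obtain ⟨y, hy, rfl⟩ := Finset.mem_map.1 hx
        exact (mem_primitiveRoots (by norm_num)).2
          ((isPrimitiveRoot_of_mem_primitiveRoots hy).map_of_injective
            (f := algebraMap S ℂ) hinj)
      · rw [Finset.card_map, hζ.card_primitiveRoots, hζS.card_primitiveRoots]
    rw [himg, Finset.prod_map] at hprod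
    simp only [map_prod, map_add, map_mul, map_pow, map_neg, map_intCast,
      ← Polynomial.aeval_algebraMap_apply]
    exact hprod.symm
  have h7 : (7 : S) ≠ 0 := by norm_num
  have h7u : ¬ IsUnit (7 : S) := by
    rw [isUnit_iff_exists_inv]
    rintro ⟨s, hs⟩
    have hs' : (s : ℂ) = algebraMap ℚ ℂ (1 / 7) := by
      have : (7 : ℂ) * s = 1 := congrArg (algebraMap S ℂ) hs
      rw [map_div₀, map_one, map_ofNat]
      field_simp
      linear_combination this
    have hint : IsIntegral ℤ (1 / 7 : ℚ) := by
      rw [← isIntegral_algebraMap_iff (algebraMap ℚ ℂ).injective, ← hs']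
      exact s.2
    obtain ⟨y, hy⟩ := IsIntegrallyClosed.isIntegral_iff.1 hint
    have h1 : (y : ℚ) * 7 = 1 := by
      have : (y : ℚ) = 1 / 7 := hy
      rw [this]; norm_num
    have : y * 7 = 1 := by exact_mod_cast h1
    omega
  obtain ⟨M, hM, hmem⟩ := exists_max_ideal_of_mem_nonunits h7u
  let k := S ⧸ M
  let : Field k := Ideal.Quotient.field M
  let φ : S →+* k := Ideal.Quotient.mk M
  have h7k : (7 : k) = 0 := by
    rw [← map_ofNat φ 7]
    exact Ideal.Quotient.eq_zero_iff_mem.2 hmem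
  have : CharP k 7 :=
    (CharP.charP_iff_prime_eq_zero (by norm_num)).2 (by exact_mod_cast h7k)
  obtain ⟨m', hmm', hm'⟩ := FiniteMultiplicity.exists_eq_pow_mul_and_not_dvd
    (Int.finiteMultiplicity_iff (a := 7).2 ⟨by decide, hm⟩)
  generalize multiplicity 7 m = n at hmm'
  subst hmm'
  have hm'k : (m' : k) ≠ 0 := by rwa [Ne, CharP.intCast_eq_zero_iff k 7]
  have hroot : (φ ωS - 2) * (φ ωS - 4) = 0 := by
    have h := congrArg φ hω2
    simp only [map_add, map_pow, map_one, map_zero] at h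
    linear_combination h + (1 - φ ωS) * h7k
  have hφw : φ (m' ^ 6 * (-ωS) ^ t) = (-φ ωS) ^ t := by
    rw [map_mul, map_pow, map_pow, map_intCast, intCast_pow_six_eq_one hm'k, one_mul, map_neg]
  have key : ∀ r r' : ℤ, φ ωS = r → r + r' = 6 → r * r' = 8 → ((-r) ^ t : ℤ) = (1 : k) := by
    intro r r' hr hs hp
    have hφr : φ (m' ^ 6 * (-ωS) ^ t) = ((-r) ^ t : ℤ) := by rw [hφw, hr]; push_cast; rfl
    rw [← hφr]
    refine map_eq_one_of_prod_eq_seven_pow_mul h7 hζS hω2 φ hr hs hp (6 * n) P Q _ ?_ ?_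
    · rw [hφw]
      refine pow_ne_zero _ (neg_ne_zero.2 fun h0 => one_ne_zero (α := k) ?_)
      have h := congrArg φ hω2
      simp [h0] at h
    · rw [hprodS]; push_cast; ring
  have hkey : ∀ c : ℤ, (c : k) = 1 → (7 : ℤ) ∣ c - 1 := fun c hc => by
    refine (CharP.intCast_eq_zero_iff k 7 _).1 ?_
    rw [Int.cast_sub, hc, Int.cast_one, sub_self]
  rcases mul_eq_zero.1 hroot with h | h
  · have := hkey _ (key 2 4 (by push_cast; linear_combination h) (by norm_num) (by norm_num))
    rcases ht with rfl | rfl | rfl | rfl | rfl <;> revert this <;> decide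
  · have := hkey _ (key 4 2 (by push_cast; linear_combination h) (by norm_num) (by norm_num))
    rcases ht with rfl | rfl | rfl | rfl | rfl <;> revert this <;> decide
end
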